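/- Let 0 < α < 1, λ > 0, and t > 0. Then the function t ↦ E_{α,α}(−λ t^{α}) is differentiable at t and its derivative equals (1/t) · ( (1 − α) E_{α,α}(−λ t^{α}) + E_{α,α−1}(−λ t^{α}) ), where E_{ρ,μ}(z) = ∑_{n=0}^∞ z^n / Γ(ρn + μ) is the two-parameter Mittag-Leffler function. -/

import Mathlib

open Real

/-- The two-parameter Mittag-Leffler function `E_{ρ,μ}(z) = ∑_{n≥0} z^n / Γ(ρn + μ)`. -/
noncomputable def mittagLeffler (ρ μ z : ℝ) : ℝ :=
  ∑' n : ℕ, z ^ n / Real.Gamma (ρ * n + μ)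

theorem rpow_mul_exp_neg_le_Gamma {M s : ℝ} (hM : 0 < M) (hs : 1 ≤ s) :
    M ^ (s - 1) * Real.exp (-M) ≤ Real.Gamma s := by
  have hs0 : 0 < s := by linarith
  have hint := Real.GammaIntegral_convergent hs0
  have hsub : Set.Ioi M ⊆ Set.Ioi 0 := Set.Ioi_subset_Ioi hM.le
  calc M ^ (s - 1) * Real.exp (-M) = ∫ x in Set.Ioi M, Real.exp (-x) * M ^ (s - 1) := by
        rw [MeasureTheory.integral_mul_const, integral_exp_neg_Ioi, mul_comm]
    _ ≤ ∫ x in Set.Ioi M, Real.exp (-x) * x ^ (s - 1) := by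
        refine MeasureTheory.setIntegral_mono_on ((integrableOn_exp_neg_Ioi M).mul_const _)
          (hint.mono_set hsub) measurableSet_Ioi fun x hx => ?_
        have hx' : M ≤ x := le_of_lt hx
        have : 0 ≤ s - 1 := by linarith
        gcongr
    _ ≤ ∫ x in Set.Ioi 0, Real.exp (-x) * x ^ (s - 1) := by
        refine MeasureTheory.setIntegral_mono_set hint ?_ hsub.eventuallyLE
        filter_upwards [MeasureTheory.ae_restrict_mem measurableSet_Ioi] with x hx
        have : (0 : ℝ) < x := hx
        simp only [Pi.zero_apply]
        positivity
    _ = Real.Gamma s := (Real.Gamma_eq_integral hs0).symm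

theorem summable_pow_mul_mittagLeffler_term (k : ℕ) {ρ : ℝ} (hρ : 0 < ρ) (μ r : ℝ) :
    Summable fun n : ℕ => (n : ℝ) ^ k * (r ^ n / Real.Gamma (ρ * n + μ)) := by
  set A : ℝ := 2 * |r| + 1 with hA
  have hA0 : 0 < A := by positivity
  set M : ℝ := A ^ ρ⁻¹ with hM
  have hM0 : 0 < M := by positivity
  have hMA : M ^ ρ = A := Real.rpow_inv_rpow hA0.le hρ.ne'
  have hq : ‖|r| / A‖ < 1 := by
    rw [Real.norm_of_nonneg (by positivity), div_lt_one hA0]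
    linarith [abs_nonneg r]
  have hlarge : ∀ᶠ n : ℕ in Filter.atTop, 1 ≤ ρ * n + μ :=
    (Filter.tendsto_atTop_add_const_right _ μ
      (tendsto_natCast_atTop_atTop.const_mul_atTop hρ)).eventually_ge_atTop 1
  refine Summable.of_norm_bounded_eventually_nat
    ((summable_pow_mul_geometric_of_norm_lt_one k hq).mul_right
      (M ^ (μ - 1) * Real.exp (-M))⁻¹) ?_
  filter_upwards [hlarge] with n hn
  have hΓ := rpow_mul_exp_neg_le_Gamma hM0 hn
  have hsplit : M ^ (ρ * n + μ - 1) = A ^ n * M ^ (μ - 1) := by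
    rw [add_sub_assoc, Real.rpow_add hM0, Real.rpow_mul hM0.le, hMA, Real.rpow_natCast]
  have hΓ0 : 0 < Real.Gamma (ρ * n + μ) := Real.Gamma_pos_of_pos (by linarith)
  rw [hsplit] at hΓ
  calc ‖(n : ℝ) ^ k * (r ^ n / Real.Gamma (ρ * n + μ))‖
      = (n : ℝ) ^ k * (|r| ^ n / Real.Gamma (ρ * n + μ)) := by
        simp [abs_of_pos hΓ0]
    _ ≤ (n : ℝ) ^ k * (|r| ^ n / (A ^ n * M ^ (μ - 1) * Real.exp (-M))) := by gcongr
    _ = (n : ℝ) ^ k * (|r| / A) ^ n * (M ^ (μ - 1) * Real.exp (-M))⁻¹ := by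
        rw [div_pow]
        field_simp

theorem summable_mittagLeffler_term {ρ : ℝ} (hρ : 0 < ρ) (μ z : ℝ) :
    Summable fun n : ℕ => z ^ n / Real.Gamma (ρ * n + μ) := by
  simpa using summable_pow_mul_mittagLeffler_term 0 hρ μ z

theorem hasDerivAt_mittagLeffler {ρ : ℝ} (hρ : 0 < ρ) (μ z : ℝ) :
    HasDerivAt (mittagLeffler ρ μ)
      (∑' n : ℕ, n * z ^ (n - 1) / Real.Gamma (ρ * n + μ)) z := by
  set R : ℝ := |z| + 1 with hR
  have hR0 : 0 < R := by positivity
  have hu : Summable fun n : ℕ => ‖n * R ^ (n - 1) / Real.Gamma (ρ * n + μ)‖ := by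
    refine ((summable_pow_mul_mittagLeffler_term 1 hρ μ R).mul_right R⁻¹).norm.congr fun n => ?_
    congr 1
    rcases n with _ | n
    · simp
    · simp only [pow_succ, pow_zero, one_mul, Nat.add_sub_cancel]
      field_simp
  refine hasDerivAt_tsum_of_isPreconnected hu Metric.isOpen_ball
    (convex_ball (0 : ℝ) R).isPreconnected
    (fun n y _ => (hasDerivAt_pow n y).div_const _) (fun n y hy => ?_)
    (Metric.mem_ball_self hR0) (summable_mittagLeffler_term hρ μ 0) ?_
  · have hy' : |y| ≤ R := by simpa using (mem_ball_zero_iff.mp hy).le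
    simp only [norm_div, norm_mul, norm_pow, Real.norm_eq_abs, abs_of_pos hR0]
    gcongr
  · simp [hR]

theorem inv_Gamma_eq_mul_inv_Gamma_add_one (s : ℝ) :
    (Real.Gamma s)⁻¹ = s * (Real.Gamma (s + 1))⁻¹ := by
  rcases eq_or_ne s 0 with rfl | hs
  · simp
  · rw [Real.Gamma_add_one hs, mul_inv, mul_inv_cancel_left₀ hs]

theorem mul_tsum_deriv_mittagLeffler {ρ : ℝ} (hρ : 0 < ρ) (μ z : ℝ) :
    ρ * z * ∑' n : ℕ, n * z ^ (n - 1) / Real.Gamma (ρ * n + μ) =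
      (1 - μ) * mittagLeffler ρ μ z + mittagLeffler ρ (μ - 1) z := by
  unfold mittagLeffler
  rw [← tsum_mul_left, ← tsum_mul_left,
    ← ((summable_mittagLeffler_term hρ μ z).mul_left (1 - μ)).tsum_add
      (summable_mittagLeffler_term hρ (μ - 1) z)]
  refine tsum_congr fun n => ?_
  have hΓ := inv_Gamma_eq_mul_inv_Gamma_add_one (ρ * n + (μ - 1))
  rw [show ρ * n + (μ - 1) + 1 = ρ * n + μ by ring] at hΓ
  have hz : n * z ^ (n - 1) * z = n * z ^ n := by
    rcases n with _ | n
    · simp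
    · simp only [Nat.add_sub_cancel, pow_succ, mul_assoc]
  simp only [div_eq_mul_inv, hΓ]
  linear_combination ρ * (Real.Gamma (ρ * n + μ))⁻¹ * hz

/-- For `0 < α < 1`, `λ > 0` and `t > 0`, the function `t ↦ E_{α,α}(−λ t^α)` is differentiable
at `t` with derivative `(1/t)((1 − α) E_{α,α}(−λ t^α) + E_{α,α−1}(−λ t^α))`. -/
theorem stmt15 (α l t : ℝ) (hα : 0 < α) (hα1 : α < 1) (hl : 0 < l) (ht : 0 < t) :
    HasDerivAt (fun s : ℝ => mittagLeffler α α (-(l * s ^ α)))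
      ((1 / t) * ((1 - α) * mittagLeffler α α (-(l * t ^ α))
        + mittagLeffler α (α - 1) (-(l * t ^ α)))) t := by
  have hpow : HasDerivAt (fun s : ℝ => -(l * s ^ α)) (-(l * (α * t ^ (α - 1)))) t :=
    ((Real.hasDerivAt_rpow_const (Or.inl ht.ne')).const_mul l).neg
  refine ((hasDerivAt_mittagLeffler hα α (-(l * t ^ α))).comp t hpow).congr_deriv ?_
  rw [← mul_tsum_deriv_mittagLeffler hα, Real.rpow_sub_one ht.ne']
  ring
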